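/- The group of units of the ring Z/4[x]/(x^2 - 2, 2x) is cyclic of order 4. -/

import Mathlib

open Polynomial

/-- A commutative ring of characteristic dividing four, additively generated by `1` and an element
`x` with `x ^ 2 = 2 ≠ 0` and `2 * x = 0`, has cyclic unit group of order four, generated
by `1 + x`. -/
theorem isCyclic_units_and_card_units_eq_four {R : Type*} [CommRing R] (x : R)
    (h4 : (4 : R) = 0) (hx : x ^ 2 = 2) (h2x : 2 * x = 0) (h2 : (2 : R) ≠ 0)
    (hspan : ∀ r : R, ∃ m n : ℕ, r = m + n * x) :
    IsCyclic Rˣ ∧ Nat.card Rˣ = 4 := by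
  have hmul : (1 + x) * (3 + x) = 1 := by linear_combination hx + 2 * h2x + h4
  let u : Rˣ := Units.mkOfMulEqOne (1 + x) (3 + x) hmul
  have hu : (u : R) = 1 + x := rfl
  have hu2 : (u : R) ^ 2 = 3 := by rw [hu]; linear_combination hx + h2x
  have hgen : ∀ v : Rˣ, v ∈ Subgroup.zpowers u := by
    intro v
    suffices ∃ k : ℕ, u ^ k = v by
      obtain ⟨k, rfl⟩ := this
      exact Subgroup.npow_mem_zpowers u k
    obtain ⟨m, n, hv⟩ := hspan v
    obtain ⟨k, rfl | rfl⟩ := Nat.even_or_odd' m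
    · refine absurd ((Units.mul_left_eq_zero v).1 ?_) h2
      rw [hv]
      push_cast
      linear_combination (k : R) * h4 + (n : R) * h2x
    · obtain ⟨j, rfl | rfl⟩ := Nat.even_or_odd' k <;>
        obtain ⟨i, rfl | rfl⟩ := Nat.even_or_odd' n
      · refine ⟨0, Units.ext ?_⟩
        rw [hv]
        push_cast
        linear_combination -(j : R) * h4 - (i : R) * h2x
      · refine ⟨1, Units.ext ?_⟩
        rw [hv]
        push_cast
        linear_combination hu - (j : R) * h4 - (i : R) * h2x
      · refine ⟨2, Units.ext ?_⟩
        rw [hv]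
        push_cast
        linear_combination hu2 - (j : R) * h4 - (i : R) * h2x
      · refine ⟨3, Units.ext ?_⟩
        rw [hv]
        push_cast
        linear_combination (u : R) * hu2 + 3 * hu + h2x - (j : R) * h4 - (i : R) * h2x
  have hord : orderOf u = 2 ^ (1 + 1) := by
    refine orderOf_eq_prime_pow (fun h => h2 ?_) (Units.ext ?_)
    · have h' := congrArg Units.val h
      push_cast at h'
      linear_combination h' - hu2
    · push_cast
      linear_combination ((u : R) ^ 2 + 3) * hu2 + 2 * h4
  exact ⟨⟨u, hgen⟩, (orderOf_eq_card_of_forall_mem_zpowers hgen).symm.trans hord⟩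

theorem C_two_notMem_span :
    (C 2 : (ZMod 4)[X]) ∉ Ideal.span {(X : (ZMod 4)[X]) ^ 2 - C 2, C 2 * X} := by
  rw [Ideal.mem_span_pair]
  rintro ⟨f, g, h⟩
  have h' : f * X ^ 2 - C 2 * f + C 2 * (g * X) = C 2 := by linear_combination h
  have h0 := congrArg (coeff · 0) h'
  have h2 := congrArg (coeff · 2) h'
  simp only [coeff_add, coeff_sub, coeff_C, mul_coeff_zero, coeff_X_zero] at h0
  simp only [coeff_add, coeff_sub, coeff_C_mul, coeff_mul_X_pow', coeff_C, coeff_mul_X] at h2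
  norm_num at h0 h2
  generalize f.coeff 0 = a at h0 h2
  generalize f.coeff 2 = b at h0 h2
  generalize g.coeff 1 = c at h0 h2
  revert a b c
  decide

theorem exists_map_eq_natCast_add_natCast_mul {k : ℕ} [NeZero k] {R : Type*} [CommRing R]
    (π : (ZMod k)[X] →+* R) (hx : π X ^ 2 = 2) (p : (ZMod k)[X]) :
    ∃ m n : ℕ, π p = m + n * π X := by
  induction p using Polynomial.induction_on with
  | C a =>
    refine ⟨a.val, 0, ?_⟩
    rw [← ZMod.natCast_zmod_val a, C_eq_natCast, map_natCast, ZMod.natCast_zmod_val]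
    simp
  | add p q hp hq =>
    obtain ⟨m, n, hp⟩ := hp
    obtain ⟨m', n', hq⟩ := hq
    refine ⟨m + m', n + n', ?_⟩
    rw [map_add, hp, hq]
    push_cast
    ring
  | monomial k a h =>
    obtain ⟨m, n, h⟩ := h
    refine ⟨2 * n, m, ?_⟩
    rw [pow_succ, ← mul_assoc, map_mul, h]
    push_cast
    linear_combination (n : R) * hx

theorem isCyclic_units_and_card_units_eq_four_of_ker_eq {R : Type*} [CommRing R]
    (π : (ZMod 4)[X] →+* R) (hπ : Function.Surjective π)
    (hker : RingHom.ker π = Ideal.span {(X : (ZMod 4)[X]) ^ 2 - C 2, C 2 * X}) :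
    IsCyclic Rˣ ∧ Nat.card Rˣ = 4 := by
  have hx : π X ^ 2 = 2 := by
    have h : π (X ^ 2 - C 2) = 0 := by
      rw [← RingHom.mem_ker, hker]
      exact Ideal.subset_span (by simp)
    rw [C_ofNat, map_sub, map_pow, map_ofNat] at h
    exact sub_eq_zero.1 h
  have h2x : 2 * π X = 0 := by
    have h : π (C 2 * X) = 0 := by
      rw [← RingHom.mem_ker, hker]
      exact Ideal.subset_span (by simp)
    rwa [C_ofNat, map_mul, map_ofNat] at h
  have h4 : (4 : R) = 0 := by
    have h : π (C 4) = 0 := by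
      rw [show (4 : ZMod 4) = 0 from rfl, C_0, map_zero]
    rwa [C_ofNat, map_ofNat] at h
  have h2 : (2 : R) ≠ 0 := by
    intro h
    apply C_two_notMem_span
    rw [← hker, RingHom.mem_ker]
    rwa [C_ofNat, map_ofNat]
  refine isCyclic_units_and_card_units_eq_four (π X) h4 hx h2x h2 fun r => ?_
  obtain ⟨p, rfl⟩ := hπ r
  exact exists_map_eq_natCast_add_natCast_mul π hx p

theorem fuchs_stmt11 :
    let R := Polynomial (ZMod 4) ⧸
      Ideal.span {(X : Polynomial (ZMod 4)) ^ 2 - C 2, C 2 * X}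
    IsCyclic Rˣ ∧ Nat.card Rˣ = 4 :=
  isCyclic_units_and_card_units_eq_four_of_ker_eq (Ideal.Quotient.mk _)
    Ideal.Quotient.mk_surjective Ideal.mk_ker
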